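/- (Functional incompleteness of binary connectives modulo free valuation congruence) Suppose |A| > 2 and let a, b, c ∈ A be pairwise distinct. Then there is no term t ∈ T_C^{1,2}(A) with t =_fr a◁b▷c; hence the ternary conditional operator cannot be expressed modulo free valuation congruence by any collection of unary and binary connectives definable with conditional composition. -/

import Mathlib

/-- Propositional statements over atoms `A`: constants `T`, `F`, an atom `a`
for each `a ∈ A`, and the ternary conditional composition
`cond x y z = x ◁ y ▷ z` (with `y` the central condition). -/
inductive PS (A : Type) : Type where
  | tt : PS A
  | ff : PS A
  | atom : A → PS A
  | cond : PS A → PS A → PS A → PS A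

/-- A valuation algebra (VA) over `A`. -/
structure VA (A : Type) where
  Val : Type
  Tv : Val
  Fv : Val
  yd : A → Val → Bool
  dv : A → Val → Val
  yd_T : ∀ a, yd a Tv = true
  yd_F : ∀ a, yd a Fv = false
  dv_T : ∀ a, dv a Tv = Tv
  dv_F : ∀ a, dv a Fv = Fv

variable {A : Type}

mutual
  /-- Evaluation `P/H` of a propositional statement over a valuation `H`. -/
  def PS.eval (V : VA A) : PS A → V.Val → Bool
    | .tt, _ => true
    | .ff, _ => false
    | .atom a, H => V.yd a H
    | .cond p q r, H =>
        if PS.eval V q H then PS.eval V p (PS.deriv V q H)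
        else PS.eval V r (PS.deriv V q H)
  /-- The generalized derivative `∂_P(H)`. -/
  def PS.deriv (V : VA A) : PS A → V.Val → V.Val
    | .tt, H => H
    | .ff, H => H
    | .atom a, H => V.dv a H
    | .cond p q r, H =>
        if PS.eval V q H then PS.deriv V p (PS.deriv V q H)
        else PS.deriv V r (PS.deriv V q H)
end

/-- `K`-equivalence: equal evaluation results in all members of the class `K`. -/
def KEquiv (K : VA A → Prop) (P Q : PS A) : Prop :=
  ∀ V : VA A, K V → ∀ H : V.Val, PS.eval V P H = PS.eval V Q H

/-- A congruence with respect to conditional composition. -/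
def IsCondCongruence (R : PS A → PS A → Prop) : Prop :=
  Equivalence R ∧
    ∀ ⦃x x' y y' z z' : PS A⦄, R x x' → R y y' → R z z' →
      R (PS.cond x y z) (PS.cond x' y' z')

/-- `K`-congruence: the largest congruence contained in `K`-equivalence. -/
def KCong (K : VA A → Prop) (P Q : PS A) : Prop :=
  ∃ R : PS A → PS A → Prop,
    IsCondCongruence R ∧ (∀ x y, R x y → KEquiv K x y) ∧ R P Q

/-- Derivability (of closed equations) in equational logic from the axioms `CP`
together with an additional set `Ax` of equational axioms. -/
inductive Deriv (Ax : PS A → PS A → Prop) : PS A → PS A → Prop where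
  | ax {p q} : Ax p q → Deriv Ax p q
  | cp1 (x y) : Deriv Ax (.cond x .tt y) x
  | cp2 (x y) : Deriv Ax (.cond x .ff y) y
  | cp3 (x) : Deriv Ax (.cond .tt x .ff) x
  | cp4 (x y z u v) :
      Deriv Ax (.cond x (.cond y z u) v)
               (.cond (.cond x y v) z (.cond x u v))
  | refl (x) : Deriv Ax x x
  | symm {p q} : Deriv Ax p q → Deriv Ax q p
  | trans {p q r} : Deriv Ax p q → Deriv Ax q r → Deriv Ax p r
  | congr {x x' y y' z z'} : Deriv Ax x x' → Deriv Ax y y' → Deriv Ax z z' →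
      Deriv Ax (.cond x y z) (.cond x' y' z')

/-- No additional axioms: plain `CP`. -/
def NoAx : PS A → PS A → Prop := fun _ _ => False

/-- The class `fr` of free valuation algebras: all VAs. -/
def frK : VA A → Prop := fun _ => True

/-- The class `rp` of repetition-proof VAs. -/
def rpK (V : VA A) : Prop :=
  ∀ (a : A) (x : V.Val), V.yd a x = V.yd a (V.dv a x)

/-- The class `cr` of contractive VAs. -/
def crK (V : VA A) : Prop :=
  rpK V ∧ ∀ (a : A) (x : V.Val), V.dv a (V.dv a x) = V.dv a x

/-- The class `wm` of weakly memorizing VAs. -/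
def wmK (V : VA A) : Prop :=
  crK V ∧ ∀ (a b : A) (x : V.Val),
    V.yd b (V.dv a x) = V.yd a x →
      V.dv a (V.dv b (V.dv a x)) = V.dv b (V.dv a x) ∧
      V.yd a (V.dv b (V.dv a x)) = V.yd a x

/-- The class `mem` of memorizing VAs. -/
def memK (V : VA A) : Prop :=
  crK V ∧ ∀ (a b : A) (x : V.Val),
    V.dv a (V.dv b (V.dv a x)) = V.dv b (V.dv a x) ∧
    V.yd a (V.dv b (V.dv a x)) = V.yd a x

/-- The class `st` of static VAs. -/
def stK (V : VA A) : Prop :=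
  ∀ (a b : A) (x : V.Val), V.yd a (V.dv b x) = V.yd a x

/-- Substitution of terms for variables (atoms). -/
def PS.substVar {X Y : Type} (σ : X → PS Y) : PS X → PS Y
  | .tt => .tt
  | .ff => .ff
  | .atom x => σ x
  | .cond p q r => .cond (p.substVar σ) (q.substVar σ) (r.substVar σ)

/-- `T_C^{1,2}(X)`: the smallest set of terms over variables `X` containing
`T` and `F`, all terms of `T_C({x})` for `x ∈ X` (coded as terms over the
one-element variable set `Unit`), all terms of `T_C({x,y})` for `x, y ∈ X`
(coded as terms over the two-element variable set `Bool`), and closed under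
substitution. -/
inductive T12 {X : Type} : PS X → Prop where
  | tt : T12 .tt
  | ff : T12 .ff
  | one (x : X) (t : PS Unit) : T12 (t.substVar fun _ => .atom x)
  | two (x y : X) (t : PS Bool) :
      T12 (t.substVar fun b => if b then .atom x else .atom y)
  | subst {t : PS X} (σ : X → PS X) : T12 t → (∀ x, T12 (σ x)) →
      T12 (t.substVar σ)

/-- `T_C^{1,2}(A)`: the closed terms obtained by substituting constants from
`A` for the variables in terms of `T_C^{1,2}(X)` (with `X = ℕ` a countable
set of variables). -/
def TC12A {A : Type} (t : PS A) : Prop :=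
  ∃ (s : PS ℕ) (f : ℕ → A), T12 s ∧ t = s.substVar (fun n => .atom (f n))

/-- Evaluation trees: leaves carry a truth value, and an inner node evaluates an atom and continues
with the left subtree on `true` and with the right subtree on `false`. -/
inductive EvalTree (A : Type) : Type where
  | leaf : Bool → EvalTree A
  | node : A → EvalTree A → EvalTree A → EvalTree A

namespace EvalTree

/-- Replace the `true` leaves by `l` and the `false` leaves by `r`. -/
def graft : EvalTree A → EvalTree A → EvalTree A → EvalTree A
  | leaf v, l, r => if v then l else r
  | node a x y, l, r => node a (x.graft l r) (y.graft l r)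

/-- Replace every inner node labelled `x` by the tree `g x`. -/
def subst {X : Type} (g : X → EvalTree A) : EvalTree X → EvalTree A
  | leaf v => leaf v
  | node x l r => (g x).graft (l.subst g) (r.subst g)

/-- The atom that is evaluated first, if any. -/
def root : EvalTree A → Option A
  | leaf _ => none
  | node a _ _ => some a

theorem graft_graft (t l r l' r' : EvalTree A) :
    (t.graft l r).graft l' r' = t.graft (l.graft l' r') (r.graft l' r') := by
  induction t with
  | leaf v => cases v <;> simp [graft]
  | node a x y hx hy => simp [graft, hx, hy]

theorem subst_graft {X : Type} (g : X → EvalTree A) (t l r : EvalTree X) :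
    (t.graft l r).subst g = (t.subst g).graft (l.subst g) (r.subst g) := by
  induction t with
  | leaf v => cases v <;> simp [graft, subst]
  | node a x y hx hy => simp [graft, subst, hx, hy, graft_graft]

theorem graft_leaf (t : EvalTree A) : t.graft (leaf true) (leaf false) = t := by
  induction t with
  | leaf v => cases v <;> simp [graft]
  | node a x y hx hy => simp [graft, hx, hy]

theorem exists_root_eq_of_root_subst {X : Type} {g : X → EvalTree A} {u : EvalTree X} {d : A}
    (h : (u.subst g).root = some d) : ∃ x, (g x).root = some d := by
  induction u with
  | leaf v => simp [subst, root] at h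
  | node x l r hl hr =>
    rw [subst] at h
    cases hx : g x with
    | leaf v =>
      rw [hx] at h
      cases v
      · exact hr (by simpa [graft] using h)
      · exact hl (by simpa [graft] using h)
    | node e y z =>
      rw [hx] at h
      exact ⟨x, by rw [hx]; exact h⟩

/-- The tree of `a ◁ b ▷ c` (for `v = true`) or of its negation (for `v = false`). -/
def condTree (a b c : A) (v : Bool) : EvalTree A :=
  node b (node a (leaf v) (leaf !v)) (node c (leaf v) (leaf !v))

theorem graft_eq_leaf {t l r : EvalTree A} {v : Bool} (h : t.graft l r = leaf v) :
    ∃ w, t = leaf w ∧ (if w then l else r) = leaf v := by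
  cases t with
  | leaf w => exact ⟨w, rfl, h⟩
  | node e x y => simp [graft] at h

theorem graft_eq_atom {t l r : EvalTree A} {d : A} {v : Bool}
    (h : t.graft l r = node d (leaf v) (leaf !v)) :
    (∃ w, t = leaf w ∧ (if w then l else r) = node d (leaf v) (leaf !v)) ∨
      ∃ w, t = node d (leaf w) (leaf !w) ∧ (if w then l else r) = leaf v ∧
        (if w then r else l) = leaf (!v) := by
  cases t with
  | leaf w => exact .inl ⟨w, rfl, h⟩
  | node e x y =>
    simp only [graft, node.injEq] at h
    obtain ⟨rfl, hx, hy⟩ := h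
    obtain ⟨w, rfl, hw⟩ := graft_eq_leaf hx
    obtain ⟨w', rfl, hw'⟩ := graft_eq_leaf hy
    refine .inr ⟨w, ?_⟩
    cases w <;> cases w' <;> cases v <;> simp_all

/-- A tree whose grafting yields the tree of `a ◁ b ▷ c` or its negation is trivial, or is itself
such a tree, or only evaluates `b`. -/
theorem graft_eq_condTree {a b c : A} (hac : a ≠ c) {t l r : EvalTree A} {v : Bool}
    (h : t.graft l r = condTree a b c v) :
    (∃ w, t = leaf w) ∨ (∃ w, t = condTree a b c w) ∨
      ((l.root = some a ∧ r.root = some c) ∨ (l.root = some c ∧ r.root = some a)) := by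
  cases t with
  | leaf w => exact .inl ⟨w, rfl⟩
  | node e x y =>
    simp only [graft, condTree, node.injEq] at h
    obtain ⟨rfl, hx, hy⟩ := h
    right
    obtain ⟨w, rfl, hw⟩ | ⟨w, rfl, hw, hw2⟩ := graft_eq_atom hx <;>
    obtain ⟨w', rfl, hw'⟩ | ⟨w', rfl, hw', hw2'⟩ := graft_eq_atom hy <;>
    cases w <;> cases w' <;> simp_all [root, condTree]

theorem subst_ne_condTree {a b c : A} (hab : a ≠ b) (hac : a ≠ c) (hbc : b ≠ c)
    {g : Bool → EvalTree A} (hg : ∀ i v, g i ≠ condTree a b c v) (u : EvalTree Bool) (v : Bool) :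
    u.subst g ≠ condTree a b c v := by
  induction u with
  | leaf w => simp [subst, condTree]
  | node i l r hl hr =>
    intro h
    have hb : ∃ j, (g j).root = some b := exists_root_eq_of_root_subst (by rw [h]; rfl)
    rw [subst] at h
    obtain ⟨w, hw⟩ | ⟨w, hw⟩ | hroots := graft_eq_condTree hac h
    · rw [hw] at h
      cases w
      · exact hr h
      · exact hl h
    · exact hg i w hw
    · have hac' : (∃ j, (g j).root = some a) ∧ ∃ j, (g j).root = some c := by
        obtain ⟨h₁, h₂⟩ | ⟨h₁, h₂⟩ := hroots
        · exact ⟨exists_root_eq_of_root_subst h₁, exists_root_eq_of_root_subst h₂⟩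
        · exact ⟨exists_root_eq_of_root_subst h₂, exists_root_eq_of_root_subst h₁⟩
      obtain ⟨⟨j₁, h₁⟩, j₂, h₂⟩ := hac'
      obtain ⟨j₃, h₃⟩ := hb
      cases j₁ <;> cases j₂ <;> cases j₃ <;> simp_all

/-- The result and the final valuation of evaluating a tree in a valuation algebra. -/
def run (V : VA A) : EvalTree A → V.Val → Bool × V.Val
  | leaf v, H => (v, H)
  | node a l r, H => if V.yd a H then l.run V (V.dv a H) else r.run V (V.dv a H)

theorem run_graft (V : VA A) (t l r : EvalTree A) (H : V.Val) :
    (t.graft l r).run V H =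
      if (t.run V H).1 then l.run V (t.run V H).2 else r.run V (t.run V H).2 := by
  induction t generalizing H with
  | leaf v => cases v <;> simp [graft, run]
  | node a x y hx hy =>
    simp only [graft, run]
    split <;> simp [hx, hy]

open Classical in
/-- The valuation algebra of scripts: a script lists the atoms that are expected and the replies
to them; a deviation from the script leads to the valuation `F`, its completion to `T`. -/
noncomputable def scriptVA (A : Type) : VA A where
  Val := Option (List (A × Bool))
  Tv := some []
  Fv := none
  yd _ H := match H with
    | none => false
    | some [] => true
    | some (e :: _) => e.2
  dv a H := match H with
    | none => none
    | some [] => some []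
    | some (e :: s) => if a = e.1 then some s else none
  yd_T _ := rfl
  yd_F _ := rfl
  dv_T _ := rfl
  dv_F _ := rfl

theorem run_scriptVA_none (t : EvalTree A) : (t.run (scriptVA A) none).2 = none := by
  induction t with
  | leaf v => rfl
  | node a l r hl hr => simpa [run, scriptVA] using hr

theorem run_scriptVA_node_cons (e : A) (l r : EvalTree A) (v : Bool) (s : List (A × Bool)) :
    (node e l r).run (scriptVA A) (some ((e, v) :: s)) =
      if v then l.run (scriptVA A) (some s) else r.run (scriptVA A) (some s) := by
  simp [run, scriptVA]

theorem exists_script (t : EvalTree A) :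
    ∃ s : List (A × Bool), (t.run (scriptVA A) (some s)).2 = some [] := by
  induction t with
  | leaf v => exact ⟨[], rfl⟩
  | node e l r hl hr =>
    obtain ⟨s, hs⟩ := hr
    exact ⟨(e, false) :: s, by simpa [run_scriptVA_node_cons] using hs⟩

/-- `t` and `u` yield the same result on every script, and the atom `d` cannot tell apart the
valuations they lead to. -/
def ScriptEquiv (d : A) (t u : EvalTree A) : Prop :=
  ∀ s : List (A × Bool),
    (t.run (scriptVA A) (some s)).1 = (u.run (scriptVA A) (some s)).1 ∧
    (scriptVA A).yd d (t.run (scriptVA A) (some s)).2 =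
      (scriptVA A).yd d (u.run (scriptVA A) (some s)).2

theorem ScriptEquiv.symm {d : A} {t u : EvalTree A} (h : ScriptEquiv d t u) :
    ScriptEquiv d u t :=
  fun s => ⟨(h s).1.symm, (h s).2.symm⟩

theorem ScriptEquiv.root_eq {d e : A} {l r u : EvalTree A} (h : ScriptEquiv d (node e l r) u) :
    u.root = some e := by
  obtain ⟨s, hs⟩ := exists_script r
  have h₂ := (h ((e, false) :: s)).2
  rw [run_scriptVA_node_cons, if_neg Bool.false_ne_true, hs] at h₂
  cases u with
  | leaf v => simp [run, scriptVA] at h₂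
  | node e' l' r' =>
    by_contra hne
    have hne' : e' ≠ e := fun h' => hne (congrArg some h')
    have hrun : (node e' l' r').run (scriptVA A) (some ((e, false) :: s)) =
        r'.run (scriptVA A) none := by
      simp [run, scriptVA, hne']
    rw [hrun, run_scriptVA_none] at h₂
    simp [scriptVA] at h₂

theorem ScriptEquiv.eq {d : A} {t u : EvalTree A} (h : ScriptEquiv d t u) : t = u := by
  induction t generalizing u with
  | leaf v =>
    cases u with
    | leaf w => exact congrArg leaf (h []).1
    | node e l r => simpa [root] using h.symm.root_eq
  | node e l r hl hr =>
    cases u with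
    | leaf w => simpa [root] using h.root_eq
    | node e' l' r' =>
      obtain rfl : e' = e := by simpa [root] using h.root_eq
      rw [hl (u := l') fun s => ?_, hr (u := r') fun s => ?_]
      · simpa only [run_scriptVA_node_cons, if_neg Bool.false_ne_true]
          using h ((e', false) :: s)
      · simpa only [run_scriptVA_node_cons, if_true] using h ((e', true) :: s)

end EvalTree

namespace PS

open EvalTree

/-- The evaluation tree of a term whose atoms `x` stand for the trees `g x`. -/
def toTree {X : Type} (g : X → EvalTree A) : PS X → EvalTree A
  | .tt => leaf true
  | .ff => leaf false
  | .atom x => g x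
  | .cond p q r => (q.toTree g).graft (p.toTree g) (r.toTree g)

theorem toTree_substVar {X Y : Type} (g : Y → EvalTree A) (σ : X → PS Y) (t : PS X) :
    (t.substVar σ).toTree g = t.toTree fun x => (σ x).toTree g := by
  induction t with
  | tt | ff | atom x => rfl
  | cond p q r hp hq hr => simp [substVar, toTree, hp, hq, hr]

/-- The evaluation tree of a single atom. -/
def atomTree (x : A) : EvalTree A := node x (leaf true) (leaf false)

theorem subst_toTree_atomTree {X : Type} (g : X → EvalTree A) (t : PS X) :
    (t.toTree atomTree).subst g = t.toTree g := by
  induction t with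
  | tt | ff => rfl
  | atom x => simp [toTree, atomTree, EvalTree.subst, graft_leaf]
  | cond p q r hp hq hr => simp [toTree, subst_graft, hp, hq, hr]

theorem run_toTree_atomTree (V : VA A) (t : PS A) (H : V.Val) :
    (t.toTree atomTree).run V H = (t.eval V H, t.deriv V H) := by
  induction t generalizing H with
  | tt | ff => simp [toTree, run, eval, deriv]
  | atom x => cases h : V.yd x H <;> simp [toTree, atomTree, run, eval, deriv, h]
  | cond p q r hp hq hr =>
    simp only [toTree, run_graft, eval, deriv, hp, hq, hr]
    split <;> rfl

end PS

open EvalTree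

theorem KCong.toTree_eq {t u : PS A} (d : A) (h : KCong frK t u) :
    t.toTree PS.atomTree = u.toTree PS.atomTree := by
  obtain ⟨R, ⟨hequiv, hcongr⟩, hR, htu⟩ := h
  have hd := hequiv.refl (.atom d)
  have hrun (H : (scriptVA A).Val) :
      ((t.toTree PS.atomTree).run (scriptVA A) H).1 =
          ((u.toTree PS.atomTree).run (scriptVA A) H).1 ∧
        (scriptVA A).yd d ((t.toTree PS.atomTree).run (scriptVA A) H).2 =
          (scriptVA A).yd d ((u.toTree PS.atomTree).run (scriptVA A) H).2 := by
    simp only [PS.run_toTree_atomTree]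
    exact ⟨hR _ _ htu _ trivial H,
      by simpa [PS.eval] using hR _ _ (hcongr hd htu hd) _ trivial H⟩
  exact ScriptEquiv.eq fun s => hrun (some s)

theorem T12.toTree_ne_condTree {a b c : A} (hab : a ≠ b) (hac : a ≠ c) (hbc : b ≠ c)
    {X : Type} {t : PS X} (ht : T12 t) {g : X → EvalTree A}
    (hg : ∀ x v, g x ≠ condTree a b c v) (v : Bool) : t.toTree g ≠ condTree a b c v := by
  have binary (g' : Bool → EvalTree A) (hg' : ∀ i v, g' i ≠ condTree a b c v) (t : PS Bool)
      (v : Bool) : t.toTree g' ≠ condTree a b c v := by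
    rw [← PS.subst_toTree_atomTree]
    exact subst_ne_condTree hab hac hbc hg' _ v
  induction ht generalizing g v with
  | tt | ff => simp [PS.toTree, condTree]
  | one x t =>
    have h := binary (fun _ => g x) (fun _ => hg x) (t.substVar fun _ => .atom true) v
    rw [PS.toTree_substVar] at h ⊢
    exact h
  | two x y t =>
    rw [PS.toTree_substVar]
    refine binary _ (fun i v => ?_) t v
    cases i
    · exact hg y v
    · exact hg x v
  | subst σ _ _ iht ihσ =>
    rw [PS.toTree_substVar]
    exact iht (fun x => ihσ x hg) v

/-- **Functional incompleteness of binary connectives modulo free valuation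
congruence**: if `a, b, c` are pairwise distinct atoms then no term of
`T_C^{1,2}(A)` is free-valuation congruent to `a ◁ b ▷ c`. -/
theorem conditional_not_expressible_fr {A : Type} [Countable A]
    (a b c : A) (hab : a ≠ b) (hac : a ≠ c) (hbc : b ≠ c) :
    ¬ ∃ t : PS A, TC12A t ∧
      KCong frK t (.cond (.atom a) (.atom b) (.atom c)) := by
  rintro ⟨_, ⟨s, f, hs, rfl⟩, h⟩
  refine hs.toTree_ne_condTree hab hac hbc (g := fun n => PS.atomTree (f n)) ?_ true ?_
  · simp [PS.atomTree, condTree]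
  · have h' := KCong.toTree_eq a h
    rw [PS.toTree_substVar] at h'
    simpa [PS.toTree, PS.atomTree, graft, condTree] using h'
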